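/- Let A be an atomic weakly associative relation algebra and let (B(A), T_κ, E_{κλ})_{κ,λ<3} be the suitable structure built from A. Then the complex algebra Cm B(A) satisfies axiom (C4*): for every X ⊆ B(A) and all κ,λ,μ with {κ,λ,μ} = {0,1,2}, T*_λ(T*_κ(X)) ∩ E_{λμ} ⊆ T*_κ(T*_λ(X)). -/

import Mathlib

universe u

/-- A weakly associative relation algebra: a Boolean algebra equipped with
relative multiplication `comp`, converse `conv`, and identity `one'`
satisfying the WA axioms. -/
structure WA (A : Type*) [BooleanAlgebra A] where
  comp : A → A → A
  conv : A → A
  one' : A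
  wassoc : ∀ x : A, comp (comp (x ⊓ one') ⊤) ⊤ = comp (x ⊓ one') ⊤
  rdist : ∀ x y z : A, comp (x ⊔ y) z = comp x z ⊔ comp y z
  comp_one' : ∀ x : A, comp x one' = x
  conv_conv : ∀ x : A, conv (conv x) = x
  conv_sup : ∀ x y : A, conv (x ⊔ y) = conv x ⊔ conv y
  conv_comp : ∀ x y : A, conv (comp x y) = comp (conv y) (conv x)
  tarski : ∀ x y : A, comp (conv x) (comp x y)ᶜ ≤ yᶜ

variable {A : Type u}

/-- The base set of the suitable structure of an atomic WA:
triples of atoms `s` with `s 1 ≤ s 2 ; s 0`. -/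
def BAset [BooleanAlgebra A] (W : WA A) : Set (Fin 3 → A) :=
  {s | (∀ i : Fin 3, IsAtom (s i)) ∧ s 1 ≤ W.comp (s 2) (s 0)}

/-- The relation `T_κ = {(s,t) ∈ B(A)×B(A) : s κ = t κ}`. -/
def Tk [BooleanAlgebra A] (W : WA A) (κ : Fin 3) :
    Set ((Fin 3 → A) × (Fin 3 → A)) :=
  {p | p.1 ∈ BAset W ∧ p.2 ∈ BAset W ∧ p.1 κ = p.2 κ}

/-- The sets `E_{κλ}`: all of `B(A)` when `κ = λ`, and otherwise the triples
whose entry at the third index `μ ∉ {κ,λ}` is a subidentity atom. -/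
def Ee [BooleanAlgebra A] (W : WA A) (κ lam : Fin 3) : Set (Fin 3 → A) :=
  if κ = lam then BAset W
  else {s | s ∈ BAset W ∧ ∀ μ : Fin 3, μ ≠ κ → μ ≠ lam → s μ ≤ W.one'}

/-- The operator `T*_κ(X) = {s ∈ B(A) : s κ = t κ for some t ∈ X}`. -/
def Tstar [BooleanAlgebra A] (W : WA A) (κ : Fin 3) (X : Set (Fin 3 → A)) :
    Set (Fin 3 → A) :=
  {s | s ∈ BAset W ∧ ∃ t ∈ X, s κ = t κ}

namespace WA

variable [BooleanAlgebra A] (W : WA A)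

theorem conv_mono {x y : A} (h : x ≤ y) : W.conv x ≤ W.conv y := by
  rw [← sup_eq_right, ← W.conv_sup, sup_eq_right.2 h]

theorem comp_mono_left {x y : A} (z : A) (h : x ≤ y) : W.comp x z ≤ W.comp y z := by
  rw [← sup_eq_right, ← W.rdist, sup_eq_right.2 h]

theorem comp_mono_right (z : A) {x y : A} (h : x ≤ y) : W.comp z x ≤ W.comp z y := by
  have := W.conv_mono (W.comp_mono_left (W.conv z) (W.conv_mono h))
  simpa only [W.conv_comp, W.conv_conv] using this

theorem conv_one'_comp (x : A) : W.comp (W.conv W.one') x = x := by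
  have := congrArg W.conv (W.comp_one' (W.conv x))
  simpa only [W.conv_comp, W.conv_conv] using this

theorem conv_one' : W.conv W.one' = W.one' :=
  (W.comp_one' _).symm.trans (W.conv_one'_comp _)

theorem one'_comp (x : A) : W.comp W.one' x = x := by
  simpa only [W.conv_one'] using W.conv_one'_comp x

theorem isAtom_conv {a : A} (ha : IsAtom a) : IsAtom (W.conv a) := by
  let e : A ≃o A :=
    { toFun := W.conv
      invFun := W.conv
      left_inv := W.conv_conv
      right_inv := W.conv_conv
      map_rel_iff' := fun {x y} =>
        ⟨fun h => by simpa only [Equiv.coe_fn_mk, W.conv_conv] using W.conv_mono h, W.conv_mono⟩ }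
  exact (e.isAtom_iff a).2 ha

theorem comp_conv_le_compl {x y z : A} (h : z ≤ (W.comp x y)ᶜ) : W.comp (W.conv x) z ≤ yᶜ :=
  (W.comp_mono_right _ h).trans (W.tarski x y)

/-- The cycle law rotating a triangle of atoms. -/
theorem le_conv_comp {a b c : A} (ha : IsAtom a) (hc : IsAtom c) (h : a ≤ W.comp b c) :
    c ≤ W.comp (W.conv b) a := by
  by_contra hn
  have h1 := W.comp_conv_le_compl
    (le_compl_iff_disjoint_right.2 (hc.not_le_iff_disjoint.1 hn))
  rw [W.conv_conv] at h1
  exact ha.1 (le_compl_self.1 (h.trans h1))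

theorem conv_le_comp {a b c : A} (h : a ≤ W.comp b c) :
    W.conv a ≤ W.comp (W.conv c) (W.conv b) :=
  W.conv_comp b c ▸ W.conv_mono h

/-- The cycle law reflecting a triangle of atoms. -/
theorem le_comp_conv {a b c : A} (ha : IsAtom a) (hb : IsAtom b) (h : a ≤ W.comp b c) :
    b ≤ W.comp a (W.conv c) := by
  have := W.conv_le_comp
    (W.le_conv_comp (W.isAtom_conv ha) (W.isAtom_conv hb) (W.conv_le_comp h))
  simpa only [W.conv_conv] using this

theorem comp_ne_bot {x y a : A} (ha : IsAtom a) (h : a ≤ W.comp x y) :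
    W.comp (W.conv x) a ≠ ⊥ := by
  intro h0
  have h1 : a ≤ (W.comp x ⊤)ᶜ := by
    have := W.tarski (W.conv x) a
    rwa [W.conv_conv, h0, compl_bot, le_compl_comm] at this
  exact ha.1 (le_compl_self.1
    ((h.trans (W.comp_mono_right x le_top)).trans (le_compl_comm.1 h1)))

theorem conv_eq_of_le_one' {i : A} (hi : IsAtom i) (h1 : i ≤ W.one') : W.conv i = i := by
  have h0 := W.comp_ne_bot hi (W.comp_one' i).ge
  have h2 : W.comp (W.conv i) i ≤ W.conv i :=
    (W.comp_mono_right _ h1).trans (W.comp_one' _).le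
  have h3 : W.comp (W.conv i) i ≤ i := by
    have h4 : W.conv i ≤ W.one' := W.conv_one' ▸ W.conv_mono h1
    exact (W.comp_mono_left _ h4).trans (W.one'_comp _).le
  rw [← (W.isAtom_conv hi).le_iff_eq h0 |>.1 h2, (hi.le_iff_eq h0).1 h3]

/-- The atom `i` is a subidentity atom that is the domain of the atom `a`. -/
structure IsDom (i a : A) : Prop where
  isAtom_id : IsAtom i
  le_one' : i ≤ W.one'
  isAtom : IsAtom a
  le_comp : a ≤ W.comp i a

variable {W} {a b c i : A}

theorem isDom_of_le_comp (hi : IsAtom i) (h1 : i ≤ W.one') (ha : IsAtom a)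
    (h : a ≤ W.comp i b) : W.IsDom i a := by
  refine ⟨hi, h1, ha, ?_⟩
  have h0 := W.comp_ne_bot ha h
  rw [W.conv_eq_of_le_one' hi h1] at h0
  exact ((ha.le_iff_eq h0).1 ((W.comp_mono_left a h1).trans (W.one'_comp a).le)).ge

/-- The range of an atom is the domain of its converse. -/
theorem isDom_conv_of_le_comp (hi : IsAtom i) (h1 : i ≤ W.one') (ha : IsAtom a)
    (h : a ≤ W.comp b i) : W.IsDom i (W.conv a) := by
  have := W.conv_le_comp h
  rw [W.conv_eq_of_le_one' hi h1] at this
  exact isDom_of_le_comp hi h1 (W.isAtom_conv ha) this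

theorem IsDom.le_comp_right (h : W.IsDom i (W.conv a)) : a ≤ W.comp a i := by
  have := W.conv_le_comp h.le_comp
  rwa [W.conv_conv, W.conv_eq_of_le_one' h.isAtom_id h.le_one'] at this

theorem isDom_self (hi : IsAtom i) (h1 : i ≤ W.one') : W.IsDom i i :=
  isDom_of_le_comp hi h1 hi (W.comp_one' i).ge

/-- The weak associative law: a product has the same domain as its left factor. -/
theorem IsDom.of_left (h : W.IsDom i b) (ha : IsAtom a) (habc : a ≤ W.comp b c) :
    W.IsDom i a := by
  refine isDom_of_le_comp (b := ⊤) h.isAtom_id h.le_one' ha ?_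
  have hw := W.wassoc i
  rw [inf_eq_left.2 h.le_one'] at hw
  calc a ≤ W.comp b c := habc
    _ ≤ W.comp (W.comp i ⊤) c :=
      W.comp_mono_left _ (h.le_comp.trans (W.comp_mono_right _ le_top))
    _ ≤ W.comp (W.comp i ⊤) ⊤ := W.comp_mono_right _ le_top
    _ = W.comp i ⊤ := hw

theorem IsDom.left (h : W.IsDom i a) (hb : IsAtom b) (habc : a ≤ W.comp b c) : W.IsDom i b :=
  h.of_left hb (W.le_comp_conv h.isAtom hb habc)

theorem IsDom.right_conv (h : W.IsDom i (W.conv a)) (hc : IsAtom c) (habc : a ≤ W.comp b c) :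
    W.IsDom i (W.conv c) :=
  h.left (W.isAtom_conv hc) (W.conv_le_comp habc)

theorem IsDom.of_right_conv (h : W.IsDom i (W.conv c)) (ha : IsAtom a)
    (habc : a ≤ W.comp b c) : W.IsDom i (W.conv a) :=
  h.of_left (W.isAtom_conv ha) (W.conv_le_comp habc)

theorem IsDom.right (h : W.IsDom i (W.conv b)) (ha : IsAtom a) (hc : IsAtom c)
    (habc : a ≤ W.comp b c) : W.IsDom i c :=
  h.of_left hc (W.le_conv_comp ha hc habc)

theorem IsDom.left_conv (h : W.IsDom i c) (ha : IsAtom a) (hb : IsAtom b)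
    (habc : a ≤ W.comp b c) : W.IsDom i (W.conv b) :=
  h.left (W.isAtom_conv hb) (W.le_conv_comp ha h.isAtom habc)

theorem vec_mem_BAset (ha : IsAtom a) (hb : IsAtom b) (hc : IsAtom c) (h : b ≤ W.comp c a) :
    ![a, b, c] ∈ BAset W :=
  ⟨by simp [Fin.forall_fin_succ, ha, hb, hc], h⟩

theorem eq_of_le_comp_right (h1 : i ≤ W.one') (ha : IsAtom a) (hb : IsAtom b)
    (h : a ≤ W.comp b i) : a = b :=
  (hb.le_iff_eq ha.1).1 (h.trans ((W.comp_mono_right b h1).trans (W.comp_one' b).le))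

theorem eq_of_le_comp_left (h1 : i ≤ W.one') (ha : IsAtom a) (hb : IsAtom b)
    (h : a ≤ W.comp i b) : a = b :=
  (hb.le_iff_eq ha.1).1 (h.trans ((W.comp_mono_left b h1).trans (W.one'_comp b).le))

end WA

/-- The complex algebra of the suitable structure of an atomic WA satisfies
axiom (C4*). -/
theorem stmt_8 [BooleanAlgebra A] (W : WA A)
    (hatomic : ∀ x : A, x ≠ ⊥ → ∃ a : A, IsAtom a ∧ a ≤ x)
    (X : Set (Fin 3 → A)) (hX : X ⊆ BAset W)
    (κ lam μ : Fin 3) (hkl : κ ≠ lam) (hkm : κ ≠ μ) (hlm : lam ≠ μ) :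
    Tstar W lam (Tstar W κ X) ∩ Ee W lam μ ⊆ Tstar W κ (Tstar W lam X) := by
  rintro s ⟨⟨hs, u, ⟨hu, t, ht, hut⟩, hsu⟩, hE⟩
  rw [Ee, if_neg hlm] at hE
  have hid : s κ ≤ W.one' := hE.2 κ hkl hkm
  have htB := hX ht
  suffices h : ∃ v ∈ BAset W, v κ = s κ ∧ v lam = t lam by
    obtain ⟨v, hv, hvs, hvt⟩ := h
    exact ⟨hs, v, ⟨hv, t, ht, hvt⟩, hvs.symm⟩
  obtain ⟨sa, hs⟩ := hs
  obtain ⟨ua, hu⟩ := hu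
  obtain ⟨ta, htB⟩ := htB
  have hi := sa κ
  have hcases : (κ = 0 ∧ lam = 1) ∨ (κ = 0 ∧ lam = 2) ∨ (κ = 1 ∧ lam = 0) ∨
      (κ = 1 ∧ lam = 2) ∨ (κ = 2 ∧ lam = 0) ∨ (κ = 2 ∧ lam = 1) := by omega
  rcases hcases with ⟨rfl, rfl⟩ | ⟨rfl, rfl⟩ | ⟨rfl, rfl⟩ | ⟨rfl, rfl⟩ | ⟨rfl, rfl⟩ | ⟨rfl, rfl⟩
  · have h := WA.isDom_conv_of_le_comp hi hid (sa 1) hs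
    rw [hsu] at h
    have h := h.right_conv (ua 0) hu
    rw [hut] at h
    have h := h.of_right_conv (ta 1) htB
    exact ⟨_, WA.vec_mem_BAset hi (ta 1) (ta 1) h.le_comp_right, rfl, rfl⟩
  · have h := WA.isDom_conv_of_le_comp hi hid (sa 1) hs
    rw [WA.eq_of_le_comp_right hid (sa 1) (sa 2) hs, hsu] at h
    have h := h.right (ua 1) (ua 0) hu
    rw [hut] at h
    have h := h.left_conv (ta 1) (ta 2) htB
    exact ⟨_, WA.vec_mem_BAset hi (ta 2) (ta 2) h.le_comp_right, rfl, rfl⟩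
  · have h : W.IsDom (s 1) (W.conv (s 1)) := by
      rw [W.conv_eq_of_le_one' hi hid]
      exact WA.isDom_self hi hid
    have h := h.right_conv (sa 0) hs
    rw [hsu] at h
    have h := h.of_right_conv (ua 1) hu
    rw [hut] at h
    have h := h.right_conv (ta 0) htB
    exact ⟨_, WA.vec_mem_BAset (ta 0) hi (W.isAtom_conv (ta 0))
      (W.le_conv_comp (ta 0) hi h.le_comp_right), rfl, rfl⟩
  · have h := (WA.isDom_self hi hid).left (sa 2) hs
    rw [hsu] at h
    have h := h.of_left (ua 1) hu
    rw [hut] at h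
    have h := h.left (ta 2) htB
    exact ⟨_, WA.vec_mem_BAset (W.isAtom_conv (ta 2)) hi (ta 2)
      (W.le_comp_conv (ta 2) hi h.le_comp), rfl, rfl⟩
  · have h := WA.isDom_of_le_comp hi hid (sa 1) hs
    rw [WA.eq_of_le_comp_left hid (sa 1) (sa 0) hs, hsu] at h
    have h := h.left_conv (ua 1) (ua 2) hu
    rw [hut] at h
    have h := h.right (ta 1) (ta 0) htB
    exact ⟨_, WA.vec_mem_BAset (ta 0) (ta 0) hi h.le_comp, rfl, rfl⟩
  · have h := WA.isDom_of_le_comp hi hid (sa 1) hs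
    rw [hsu] at h
    have h := h.left (ua 2) hu
    rw [hut] at h
    have h := h.of_left (ta 1) htB
    exact ⟨_, WA.vec_mem_BAset (ta 1) (ta 1) hi h.le_comp, rfl, rfl⟩
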